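/- arXiv:2508.19704 — 3 statements merged into one kernel-verified Lean document; each statement's English description precedes it below -/
import Mathlib

section
/- For every partition λ, the following identity holds in ℚ(q1,q2,z): (1 − z^{−1}) · ∏_{c∈λ} S(χ_c/z) = ∏_{c∈A(λ)} (1 − χ_c/z) / ∏_{c∈R(λ)} (1 − χ_c/(q3 z)), where S(w) := (1−q1 w)(1−q2 w)/((1−w)(1−q1 q2 w)). (This identifies the two product expressions for the function Y_λ(z).) -/
open scoped BigOperators

noncomputable section

/-- The field `ℚ(q1, q2, z)` of rational functions in three independent indeterminates. -/
abbrev K : Type := FractionRing (MvPolynomial (Fin 3) ℚ)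

/-- The indeterminate `q1`. -/
def q1 : K := algebraMap (MvPolynomial (Fin 3) ℚ) K (MvPolynomial.X 0)

/-- The indeterminate `q2`. -/
def q2 : K := algebraMap (MvPolynomial (Fin 3) ℚ) K (MvPolynomial.X 1)

/-- The indeterminate `z`. -/
def z : K := algebraMap (MvPolynomial (Fin 3) ℚ) K (MvPolynomial.X 2)

/-- `q3 = (q1 q2)⁻¹`. -/
def q3 : K := (q1 * q2)⁻¹

/-- Box content `χ_c = q1^(i-1) * q2^(j-1)` of the 1-indexed cell `(i,j)`.
Here cells of a `YoungDiagram` are 0-indexed, so the cell `c` corresponding to the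
1-indexed cell `(i,j)` is `c = (i-1, j-1)` and `χ_c = q1^c.1 * q2^c.2`. -/
def chi (c : ℕ × ℕ) : K := q1 ^ c.1 * q2 ^ c.2

/-- `c` is an addable cell of the Young diagram `d`: it is not a cell of `d` and adjoining
it again gives (the cells of) a Young diagram. -/
def IsAddable (d : YoungDiagram) (c : ℕ × ℕ) : Prop :=
  c ∉ d.cells ∧ IsLowerSet (↑(insert c d.cells) : Set (ℕ × ℕ))

/-- `c` is a removable cell of the Young diagram `d`: it is a cell of `d` and deleting
it again gives (the cells of) a Young diagram. -/
def IsRemovable (d : YoungDiagram) (c : ℕ × ℕ) : Prop :=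
  c ∈ d.cells ∧ IsLowerSet (↑(d.cells.erase c) : Set (ℕ × ℕ))

open Classical in
/-- The (finite) set `A(d)` of addable cells of `d`; every addable cell `(i,j)` satisfies
`i ≤ colLen 0` and `j ≤ rowLen 0`, so filtering the bounding box captures all of them. -/
noncomputable def addables (d : YoungDiagram) : Finset (ℕ × ℕ) :=
  (Finset.range (d.colLen 0 + 1) ×ˢ Finset.range (d.rowLen 0 + 1)).filter (IsAddable d)

open Classical in
/-- The (finite) set `R(d)` of removable cells of `d`. -/
noncomputable def removables (d : YoungDiagram) : Finset (ℕ × ℕ) :=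
  d.cells.filter (IsRemovable d)

/-- `S(w) = (1−q1 w)(1−q2 w)/((1−w)(1−q1 q2 w))`. -/
def Sfun (w : K) : K := ((1 - q1 * w) * (1 - q2 * w)) / ((1 - w) * (1 - q1 * q2 * w))

theorem mem_add_iff (d : YoungDiagram) (c : ℕ × ℕ) : c ∈ addables d ↔
    c ∉ d.cells ∧ (∀ i, c.1 = i + 1 → (i, c.2) ∈ d.cells) ∧
      (∀ j, c.2 = j + 1 → (c.1, j) ∈ d.cells) := by
  obtain ⟨a, b⟩ := c
  simp only [addables, Finset.mem_filter, Finset.mem_product, Finset.mem_range, IsAddable]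
  constructor
  · rintro ⟨-, h1, h2⟩
    refine ⟨h1, ?_, ?_⟩
    · rintro i rfl
      have h := h2 (a := (i + 1, b)) (b := (i, b)) (by simp) (by simp)
      simpa using h
    · rintro j rfl
      have h := h2 (a := (a, j + 1)) (b := (a, j)) (by simp) (by simp)
      simpa using h
  · rintro ⟨h1, h2, h3⟩
    have key : ∀ x y, x ≤ a → y ≤ b → (x, y) ≠ (a, b) → (x, y) ∈ d.cells := by
      intro x y hx hy hne
      rcases Nat.lt_or_ge x a with h | h
      · exact d.isLowerSet (a := (a - 1, b)) (by simp; omega) (h2 (a - 1) (by omega))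
      · have hxa : x = a := by omega
        subst hxa
        have : y ≠ b := fun h => hne (by rw [h])
        exact d.isLowerSet (a := (x, b - 1)) (by simp; omega) (h3 (b - 1) (by omega))
    refine ⟨⟨?_, ?_⟩, h1, ?_⟩
    · rcases a with _ | a
      · omega
      · have h := key a 0 (by omega) (by omega) (by simp)
        rw [YoungDiagram.mem_cells, YoungDiagram.mem_iff_lt_colLen] at h
        omega
    · rcases b with _ | b
      · omega
      · have h := key 0 b (by omega) (by omega) (by simp)
        rw [YoungDiagram.mem_cells, YoungDiagram.mem_iff_lt_rowLen] at h
        omega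
    · rintro ⟨p, q⟩ ⟨x, y⟩ hle hp
      simp only [Finset.coe_insert, Set.mem_insert_iff, Finset.mem_coe] at hp ⊢
      rcases hp with hp | hp
      · by_cases hne : (x, y) = (a, b)
        · exact Or.inl hne
        · right
          simp only [Prod.mk.injEq] at hp
          obtain ⟨rfl, rfl⟩ := hp
          exact key x y hle.1 hle.2 hne
      · exact Or.inr (d.isLowerSet hle hp)

theorem mem_rem_iff (d : YoungDiagram) (c : ℕ × ℕ) : c ∈ removables d ↔
    c ∈ d.cells ∧ (c.1 + 1, c.2) ∉ d.cells ∧ (c.1, c.2 + 1) ∉ d.cells := by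
  obtain ⟨a, b⟩ := c
  simp only [removables, Finset.mem_filter, IsRemovable]
  constructor
  · rintro ⟨h0, -, h2⟩
    refine ⟨h0, fun h => ?_, fun h => ?_⟩
    · have h := h2 (a := (a + 1, b)) (b := (a, b)) (by simp) (by simpa using h)
      simp at h
    · have h := h2 (a := (a, b + 1)) (b := (a, b)) (by simp) (by simpa using h)
      simp at h
  · rintro ⟨h0, h1, h2⟩
    refine ⟨h0, h0, ?_⟩
    rintro ⟨p, q⟩ ⟨x, y⟩ hle hp
    simp only [Finset.coe_erase, Set.mem_sdiff, Finset.mem_coe, Set.mem_singleton_iff] at hp ⊢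
    refine ⟨d.isLowerSet hle hp.1, fun he => ?_⟩
    simp only [Prod.mk.injEq] at he
    obtain ⟨rfl, rfl⟩ := he
    have hl1 : x ≤ p := hle.1
    have hl2 : y ≤ q := hle.2
    rcases Nat.lt_or_ge x p with h | h
    · exact h1 (d.isLowerSet (a := (p, q)) (by simp; omega) hp.1)
    · have hxa : x = p := by omega
      subst hxa
      have : y ≠ q := fun h => hp.2 (by rw [h])
      exact h2 (d.isLowerSet (a := (x, q)) (by simp; omega) hp.1)

def sh (a b : ℕ) : ℕ × ℕ ↪ ℕ × ℕ :=
  ⟨fun c => (c.1 + a, c.2 + b), fun x y h => by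
    simp only [Prod.mk.injEq] at h
    ext <;> omega⟩

theorem mem_sh (s : Finset (ℕ × ℕ)) (a b : ℕ) (c : ℕ × ℕ) :
    c ∈ s.map (sh a b) ↔ a ≤ c.1 ∧ b ≤ c.2 ∧ (c.1 - a, c.2 - b) ∈ s := by
  obtain ⟨x, y⟩ := c
  rw [Finset.mem_map]
  constructor
  · rintro ⟨⟨p, q⟩, h, he⟩
    have he : (p + a, q + b) = (x, y) := he
    rw [Prod.mk.injEq] at he
    obtain ⟨rfl, rfl⟩ := he
    simpa using h
  · rintro ⟨h1, h2, h3⟩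
    refine ⟨_, h3, ?_⟩
    change (x - a + a, y - b + b) = (x, y)
    rw [Nat.sub_add_cancel h1, Nat.sub_add_cancel h2]

theorem multi_eq (d : YoungDiagram) :
    ({(0, 0)} : Finset (ℕ × ℕ)).val + (d.cells.map (sh 1 0)).val + (d.cells.map (sh 0 1)).val
      + ((removables d).map (sh 1 1)).val =
    (addables d).val + d.cells.val + (d.cells.map (sh 1 1)).val := by
  classical
  ext ⟨x, y⟩
  simp only [Multiset.count_add, Multiset.count_eq_of_nodup (Finset.nodup _), Finset.mem_val,
    mem_sh, mem_add_iff, mem_rem_iff, Finset.mem_singleton]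
  have low : ∀ a b a' b', a' ≤ a → b' ≤ b → (a, b) ∈ d.cells → (a', b') ∈ d.cells :=
    fun a b a' b' h1 h2 h => d.isLowerSet (a := (a, b)) (by simp [h1, h2]) h
  rcases x with _ | x <;> rcases y with _ | y
  · simp
    split_ifs <;> simp_all
  · have := low 0 (y + 1) 0 y (by omega) (by omega)
    simp at this ⊢
    split_ifs <;> simp_all
  · have := low (x + 1) 0 x 0 (by omega) (by omega)
    simp at this ⊢
    split_ifs <;> simp_all
  · have h1 := low (x + 1) (y + 1) x (y + 1) (by omega) (by omega)
    have h2 := low (x + 1) (y + 1) (x + 1) y (by omega) (by omega)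
    have h3 := low (x + 1) y x y (by omega) (by omega)
    have h4 := low x (y + 1) x y (by omega) (by omega)
    simp at h1 h2 h3 h4 ⊢
    split_ifs <;> simp_all

theorem prod_eq (d : YoungDiagram) (f : ℕ × ℕ → K) :
    f (0, 0) * (∏ c ∈ d.cells, f (c.1 + 1, c.2)) * (∏ c ∈ d.cells, f (c.1, c.2 + 1))
      * (∏ c ∈ removables d, f (c.1 + 1, c.2 + 1)) =
    (∏ c ∈ addables d, f c) * (∏ c ∈ d.cells, f c) * ∏ c ∈ d.cells, f (c.1 + 1, c.2 + 1) := by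
  have h := congrArg (fun m => (Multiset.map f m).prod) (multi_eq d)
  simp only [Multiset.map_add, Multiset.prod_add] at h
  simp only [← Finset.prod_eq_multiset_prod, Finset.prod_map, Finset.prod_singleton] at h
  exact h

theorem amap_ne (p : MvPolynomial (Fin 3) ℚ) (v : Fin 3 → ℚ) (h : MvPolynomial.eval v p ≠ 0) :
    algebraMap (MvPolynomial (Fin 3) ℚ) K p ≠ 0 := by
  intro h0
  rw [map_eq_zero_iff _ (IsFractionRing.injective (MvPolynomial (Fin 3) ℚ) K)] at h0
  simp [h0] at h

theorem z_ne : z ≠ 0 := amap_ne _ (fun _ => 1) (by simp)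
theorem q1_ne : q1 ≠ 0 := amap_ne _ (fun _ => 1) (by simp)
theorem q2_ne : q2 ≠ 0 := amap_ne _ (fun _ => 1) (by simp)

theorem f_ne (c : ℕ × ℕ) : 1 - chi c / z ≠ 0 := by
  have h : z - chi c ≠ 0 := by
    have := amap_ne (MvPolynomial.X 2 - MvPolynomial.X 0 ^ c.1 * MvPolynomial.X 1 ^ c.2)
      ![1, 1, 0] (by simp)
    simpa [z, chi, q1, q2] using this
  have hz := z_ne
  intro h0
  apply h
  field_simp at h0
  simpa using h0

/-- For every partition `λ`, in `ℚ(q1,q2,z)`: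
`(1 − z⁻¹) ∏_{c∈λ} S(χ_c/z) = ∏_{c∈A(λ)} (1 − χ_c/z) / ∏_{c∈R(λ)} (1 − χ_c/(q3 z))`. -/
theorem stmt1 (d : YoungDiagram) :
    (1 - z⁻¹) * ∏ c ∈ d.cells, Sfun (chi c / z)
      = (∏ c ∈ addables d, (1 - chi c / z)) /
          ∏ c ∈ removables d, (1 - chi c / (q3 * z)) := by
  have key := prod_eq d (fun c => 1 - chi c / z)
  have hS : ∀ c, Sfun (chi c / z) = ((1 - chi (c.1 + 1, c.2) / z) * (1 - chi (c.1, c.2 + 1) / z)) /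
      ((1 - chi c / z) * (1 - chi (c.1 + 1, c.2 + 1) / z)) := by
    intro c
    have e1 : q1 * (chi c / z) = chi (c.1 + 1, c.2) / z := by simp only [chi]; ring
    have e2 : q2 * (chi c / z) = chi (c.1, c.2 + 1) / z := by simp only [chi]; ring
    have e3 : q1 * q2 * (chi c / z) = chi (c.1 + 1, c.2 + 1) / z := by simp only [chi]; ring
    rw [Sfun, e1, e2, e3]
  have hR : ∀ c, chi c / (q3 * z) = chi (c.1 + 1, c.2 + 1) / z := by
    intro c
    have h1 := q1_ne
    have h2 := q2_ne
    have hz := z_ne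
    simp only [chi, q3]
    field_simp
    ring
  have h0 : 1 - chi (0, 0) / z = 1 - z⁻¹ := by simp [chi]
  simp only [hS, hR, Finset.prod_div_distrib, Finset.prod_mul_distrib]
  rw [h0] at key
  rw [← mul_div_assoc, div_eq_div_iff]
  · linear_combination key
  · exact mul_ne_zero (Finset.prod_ne_zero_iff.2 fun c _ => f_ne c)
      (Finset.prod_ne_zero_iff.2 fun c _ => f_ne _)
  · exact Finset.prod_ne_zero_iff.2 fun c _ => f_ne _

end
end

section
/- For all partitions λ and μ, the following two identities hold in ℚ(q1,q2,z): N_{λ,μ}(z) = ∏_{c∈λ} (1 − q3^{−1} z χ_c) · ∏_{c'∈μ} Y_λ(χ_{c'}/z), and N_{λ,μ}(z) = ∏_{c'∈μ} (1 − z χ_{c'}^{−1}) · ∏_{c∈λ} ( (−q3^{−1} z χ_c) · Y_μ(q3^{−1} z χ_c) ). -/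
open scoped BigOperators

noncomputable section

/-- The (K-theoretic) Nekrasov factor
`N_{λ,μ}(w) = ∏_{(i,j)∈λ} (1 − w q1^{λ^T_j − i + 1} q2^{j − μ_i})`
`           · ∏_{(i,j)∈μ} (1 − w q1^{i − μ^T_j} q2^{λ_i − j + 1})`
written in terms of 0-indexed cells (`λ^T_j = colLen (j-1)`, `λ_i = rowLen (i-1)`). -/
def nek (lam mu : YoungDiagram) (w : K) : K :=
  (∏ c ∈ lam.cells,
      (1 - w * q1 ^ ((lam.colLen c.2 : ℤ) - (c.1 : ℤ)) *
        q2 ^ ((c.2 : ℤ) + 1 - (mu.rowLen c.1 : ℤ)))) *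
    ∏ c ∈ mu.cells,
      (1 - w * q1 ^ ((c.1 : ℤ) + 1 - (mu.colLen c.2 : ℤ)) *
        q2 ^ ((lam.rowLen c.1 : ℤ) - (c.2 : ℤ)))

/-- `Y_λ(w) = ∏_{c∈A(λ)} (1 − χ_c/w) / ∏_{c∈R(λ)} (1 − χ_c/(q3 w))`. -/
def Ycal (d : YoungDiagram) (w : K) : K :=
  (∏ c ∈ addables d, (1 - chi c / w)) / ∏ c ∈ removables d, (1 - chi c / (q3 * w))

open Finset in
theorem cells_sum {G : Type*} [AddCommGroup G] (d : YoungDiagram) (n : ℕ) (hn : d.colLen 0 ≤ n)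
    (F : ℕ → ℕ → G) :
    ∑ c ∈ d.cells, F c.1 c.2 = ∑ i ∈ range n, ∑ j ∈ range (d.rowLen i), F i j := by
  rw [Finset.sum_sigma']
  refine Finset.sum_nbij' (fun c => ⟨c.1, c.2⟩) (fun c => (c.1, c.2)) ?_ ?_ ?_ ?_ ?_
  · rintro ⟨i, j⟩ h
    have h' : (i, j) ∈ d := (YoungDiagram.mem_cells _).1 h
    have h1 := YoungDiagram.mem_iff_lt_rowLen.1 h'
    have h2 := YoungDiagram.mem_iff_lt_colLen.1 h'
    have h3 := d.colLen_anti 0 j (Nat.zero_le _)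
    simp only [mem_sigma, mem_range]
    omega
  · rintro ⟨i, j⟩ h
    simp only [mem_sigma, mem_range] at h
    exact (YoungDiagram.mem_cells _).2 (YoungDiagram.mem_iff_lt_rowLen.2 h.2)
  all_goals intros; rfl

theorem addable_iff (d : YoungDiagram) (i j : ℕ) :
    IsAddable d (i, j) ↔ j = d.rowLen i ∧ (i = 0 ∨ d.rowLen i < d.rowLen (i - 1)) := by
  unfold IsAddable
  simp only [YoungDiagram.mem_cells, YoungDiagram.mem_iff_lt_rowLen]
  constructor
  · rintro ⟨h1, h2⟩
    constructor
    · by_contra hne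
      have := @h2 (i, j) (i, j - 1) ⟨le_refl _, by simp⟩ (by simp)
      simp [YoungDiagram.mem_iff_lt_rowLen] at this
      omega
    · by_contra hne
      push Not at hne
      have := @h2 (i, j) (i - 1, j) ⟨by simp, by simp⟩ (by simp)
      simp [YoungDiagram.mem_iff_lt_rowLen] at this
      omega
  · rintro ⟨h1, h2⟩
    refine ⟨by omega, ?_⟩
    rintro ⟨a, b⟩ ⟨a', b'⟩ ⟨hl1, hl2⟩ hm
    simp only [Finset.coe_insert, Set.mem_insert_iff, Finset.mem_coe, YoungDiagram.mem_cells,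
      YoungDiagram.mem_iff_lt_rowLen, Prod.mk.injEq] at hm ⊢
    simp only at hl1 hl2
    have e1 := d.rowLen_anti a' a hl1
    rcases hm with ⟨rfl, rfl⟩ | hm
    · by_cases haa : a' = a
      · subst haa; omega
      · have e2 := d.rowLen_anti a' (a - 1) (by omega)
        omega
    · omega

theorem removable_iff (d : YoungDiagram) (i j : ℕ) :
    IsRemovable d (i, j) ↔ j + 1 = d.rowLen i ∧ d.rowLen (i + 1) < d.rowLen i := by
  unfold IsRemovable
  simp only [YoungDiagram.mem_cells, YoungDiagram.mem_iff_lt_rowLen]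
  constructor
  · rintro ⟨h1, h2⟩
    have k1 : ¬ (j + 1 < d.rowLen i) := by
      intro hh
      have := @h2 (i, j + 1) (i, j) ⟨le_refl _, by simp⟩
        (by simp [YoungDiagram.mem_iff_lt_rowLen, hh])
      simp at this
    have k2 : ¬ (j < d.rowLen (i + 1)) := by
      intro hh
      have := @h2 (i + 1, j) (i, j) ⟨by simp, by simp⟩
        (by simp [YoungDiagram.mem_iff_lt_rowLen, hh])
      simp at this
    omega
  · rintro ⟨h1, h2⟩
    refine ⟨by omega, ?_⟩
    rintro ⟨a, b⟩ ⟨a', b'⟩ ⟨hl1, hl2⟩ hm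
    simp only [Finset.coe_erase, Set.mem_sdiff, Set.mem_singleton_iff, Finset.mem_coe,
      YoungDiagram.mem_cells, YoungDiagram.mem_iff_lt_rowLen, Prod.mk.injEq] at hm ⊢
    simp only at hl1 hl2
    have e1 := d.rowLen_anti a' a hl1
    refine ⟨by omega, ?_⟩
    rintro ⟨rfl, rfl⟩
    by_cases haa : a' = a
    · subst haa; omega
    · have e2 := d.rowLen_anti (a' + 1) a (by omega)
      omega

open Finset in
theorem addables_sum {G : Type*} [AddCommGroup G] (d : YoungDiagram) (g : ℕ → ℕ → G) :
    ∑ c ∈ addables d, g c.1 c.2 = ∑ i ∈ range (d.colLen 0 + 1),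
      if i = 0 ∨ d.rowLen i < d.rowLen (i - 1) then g i (d.rowLen i) else 0 := by
  rw [← Finset.sum_filter]
  refine Finset.sum_nbij' (fun c => c.1) (fun i => (i, d.rowLen i)) ?_ ?_ ?_ ?_ ?_
  · rintro ⟨i, j⟩ h
    simp only [addables, mem_filter, mem_product, mem_range, addable_iff] at h ⊢
    exact ⟨h.1.1, h.2.2⟩
  · intro i h
    simp only [addables, mem_filter, mem_product, mem_range, addable_iff] at h ⊢
    have := d.rowLen_anti 0 i (Nat.zero_le _)
    exact ⟨⟨h.1, by omega⟩, trivial, h.2⟩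
  · rintro ⟨i, j⟩ h
    simp only [addables, mem_filter, mem_product, mem_range, addable_iff] at h ⊢
    rw [h.2.1]
  · intros; rfl
  · rintro ⟨i, j⟩ h
    simp only [addables, mem_filter, mem_product, mem_range, addable_iff] at h ⊢
    rw [h.2.1]

open Finset in
theorem removables_sum {G : Type*} [AddCommGroup G] (d : YoungDiagram) (g : ℕ → ℕ → G) :
    ∑ c ∈ removables d, g (c.1 + 1) (c.2 + 1) = ∑ i ∈ range (d.colLen 0),
      if d.rowLen (i + 1) < d.rowLen i then g (i + 1) (d.rowLen i) else 0 := by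
  rw [← Finset.sum_filter]
  refine Finset.sum_nbij' (fun c => c.1) (fun i => (i, d.rowLen i - 1)) ?_ ?_ ?_ ?_ ?_
  · rintro ⟨i, j⟩ h
    simp only [removables, mem_filter, mem_range, removable_iff, YoungDiagram.mem_cells] at h ⊢
    have h2 := YoungDiagram.mem_iff_lt_colLen.1 h.1
    have h3 := d.colLen_anti 0 j (Nat.zero_le _)
    exact ⟨by omega, h.2.2⟩
  · intro i h
    simp only [removables, mem_filter, mem_range, removable_iff, YoungDiagram.mem_cells,
      YoungDiagram.mem_iff_lt_rowLen] at h ⊢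
    omega
  · rintro ⟨i, j⟩ h
    simp only [removables, mem_filter, removable_iff] at h ⊢
    rw [← h.2.1]; rfl
  · intros; rfl
  · rintro ⟨i, j⟩ h
    simp only [removables, mem_filter, removable_iff] at h ⊢
    rw [h.2.1]

open Finset in
theorem AR_sum {G : Type*} [AddCommGroup G] (d : YoungDiagram) (g : ℕ → ℕ → G) :
    ∑ c ∈ addables d, g c.1 c.2 - ∑ c ∈ removables d, g (c.1 + 1) (c.2 + 1) =
    g 0 0 + ∑ c ∈ d.cells, ((g c.1 (c.2 + 1) - g c.1 c.2)
      - (g (c.1 + 1) (c.2 + 1) - g (c.1 + 1) c.2)) := by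
  rw [addables_sum, removables_sum, Finset.sum_range_succ',
    cells_sum d (d.colLen 0) le_rfl (fun i j => (g i (j + 1) - g i j)
      - (g (i + 1) (j + 1) - g (i + 1) j))]
  have e : ∀ i, ∑ j ∈ range (d.rowLen i), ((g i (j + 1) - g i j)
      - (g (i + 1) (j + 1) - g (i + 1) j)) =
      (g i (d.rowLen i) - g (i + 1) (d.rowLen i)) + (g (i + 1) 0 - g i 0) := by
    intro i
    rw [Finset.sum_sub_distrib, Finset.sum_range_sub, Finset.sum_range_sub (g (i + 1))]
    abel
  simp only [e, Finset.sum_add_distrib]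
  rw [Finset.sum_range_sub (fun i => g i 0)]
  simp only [true_or, if_true, Nat.add_sub_cancel, Nat.succ_ne_zero, false_or]
  have hz : d.rowLen (d.colLen 0) = 0 := by
    by_contra h
    have : (d.colLen 0, 0) ∈ d := YoungDiagram.mem_iff_lt_rowLen.2 (by omega)
    have := YoungDiagram.mem_iff_lt_colLen.1 this
    omega
  have e2 := Finset.sum_range_sub (fun i => g i (d.rowLen i)) (d.colLen 0)
  rw [hz] at e2
  have e3 : ∑ i ∈ range (d.colLen 0), (if d.rowLen (i + 1) < d.rowLen i
        then g (i + 1) (d.rowLen (i + 1)) else 0)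
      - ∑ i ∈ range (d.colLen 0), (if d.rowLen (i + 1) < d.rowLen i
        then g (i + 1) (d.rowLen i) else 0)
      = ∑ i ∈ range (d.colLen 0), (g (i + 1) (d.rowLen (i + 1)) - g i (d.rowLen i)) +
       ∑ i ∈ range (d.colLen 0), (g i (d.rowLen i) - g (i + 1) (d.rowLen i)) := by
    rw [← Finset.sum_sub_distrib, ← Finset.sum_add_distrib]
    refine Finset.sum_congr rfl fun i _ => ?_
    split_ifs with h
    · abel
    · have := d.rowLen_anti i (i + 1) (by omega)
      rw [show d.rowLen (i + 1) = d.rowLen i by omega]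
      abel
  rw [e2] at e3
  rw [add_sub_right_comm, e3]
  abel

open Finset in
theorem row_leg {G : Type*} [AddCommGroup G] (d : YoungDiagram) (n : ℕ) (hn : d.colLen 0 ≤ n)
    (i : ℕ) (F : ℕ → ℕ → G) :
    ∑ j ∈ range (d.rowLen i), F (d.colLen j) j = ∑ j ∈ range (d.rowLen i), F i j +
      ∑ k ∈ range n, if i ≤ k then ∑ j ∈ range (d.rowLen k), (F (k + 1) j - F k j) else 0 := by
  have h1 : ∀ k, (if i ≤ k then ∑ j ∈ range (d.rowLen k), (F (k + 1) j - F k j) else 0) =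
      ∑ j ∈ range (d.rowLen i), if i ≤ k ∧ k < d.colLen j then (F (k + 1) j - F k j) else 0 := by
    intro k
    by_cases h : i ≤ k
    · simp only [h, if_true, true_and]
      rw [← Finset.sum_filter]
      refine Finset.sum_congr ?_ fun _ _ => rfl
      ext j
      have := d.rowLen_anti i k h
      have e := (YoungDiagram.mem_iff_lt_rowLen (μ := d) (i := k) (j := j)).symm.trans
        YoungDiagram.mem_iff_lt_colLen
      simp only [mem_filter, mem_range, ← e]
      omega
    · simp [h]
  simp only [h1]
  rw [Finset.sum_comm, ← Finset.sum_add_distrib]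
  refine Finset.sum_congr rfl fun j hj => ?_
  have hj' : i < d.colLen j := YoungDiagram.mem_iff_lt_colLen.1
    (YoungDiagram.mem_iff_lt_rowLen.2 (by simpa using hj))
  have h3 := d.colLen_anti 0 j (Nat.zero_le _)
  rw [← Finset.sum_filter]
  have : (range n).filter (fun k => i ≤ k ∧ k < d.colLen j) = Ico i (d.colLen j) := by
    ext k; simp only [mem_filter, mem_range, mem_Ico]; omega
  rw [this, Finset.sum_Ico_eq_sum_range]
  have := Finset.sum_range_sub (fun k => F (i + k) j) (d.colLen j - i)
  simp only [← add_assoc] at this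
  rw [this, show i + (d.colLen j - i) = d.colLen j by omega]
  simp

open Finset in
theorem corr_tel {G : Type*} [AddCommGroup G] (n i : ℕ) (hi : i < n) (F : ℤ → G) :
    F i = F 0 + ∑ k ∈ range n, if k < i then F ((i : ℤ) - k) - F ((i : ℤ) - k - 1) else 0 := by
  rw [← Finset.sum_filter]
  have : (range n).filter (fun k => k < i) = range i := by
    ext k; simp only [mem_filter, mem_range]; omega
  rw [this]
  have := Finset.sum_range_sub' (fun k : ℕ => F ((i : ℤ) - k)) i
  simp only [Nat.cast_add, Nat.cast_one, ← sub_sub] at this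
  rw [this]
  simp

def Sbox {G : Type*} [AddCommGroup G] (f : ℤ → ℤ → G) (a b : ℤ) : G :=
  (f a (b + 1) - f a b) - (f (a + 1) (b + 1) - f (a + 1) b)

open Finset in
theorem tel1 {G : Type*} [AddCommGroup G] (h : ℤ → G) (a : ℕ) (l : ℤ) :
    ∑ j ∈ range a, (h ((j : ℤ) - l + 1) - h ((j : ℤ) - l)) = h (a - l) - h (-l) := by
  have := Finset.sum_range_sub (fun j : ℕ => h ((j : ℤ) - l)) a
  simp only [Nat.cast_add, Nat.cast_one, Nat.cast_zero, zero_sub] at this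
  rw [← this]
  refine Finset.sum_congr rfl fun j _ => ?_
  rw [show (j : ℤ) - l + 1 = j + 1 - l by ring]

open Finset in
theorem tel2 {G : Type*} [AddCommGroup G] (h : ℤ → G) (b : ℕ) (j : ℤ) :
    ∑ l ∈ range b, (h (j - (l : ℤ) + 1) - h (j - (l : ℤ))) = h (j + 1) - h (j + 1 - b) := by
  have := Finset.sum_range_sub' (fun l : ℕ => h (j + 1 - l)) b
  simp only [Nat.cast_add, Nat.cast_one, Nat.cast_zero, sub_zero] at this
  rw [← this]
  refine Finset.sum_congr rfl fun l _ => ?_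
  rw [show j - (l : ℤ) + 1 = j + 1 - l by ring, show j + 1 - ((l : ℤ) + 1) = j - l by ring]

open Finset in
theorem P_l {G : Type*} [AddCommGroup G] (f : ℤ → ℤ → G) (x : ℤ) (a b : ℕ) :
    ∑ l ∈ range b, ∑ j ∈ range a, Sbox f x ((j : ℤ) - l) =
    ∑ l ∈ range b, (f x (a - l) - f x (-l)) - ∑ l ∈ range b, (f (x + 1) (a - l) - f (x + 1) (-l))
    := by
  rw [← Finset.sum_sub_distrib]
  refine Finset.sum_congr rfl fun l _ => ?_
  unfold Sbox
  rw [Finset.sum_sub_distrib, tel1, tel1]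

open Finset in
theorem P_tel {G : Type*} [AddCommGroup G] (h : ℤ → G) (a b : ℕ) :
    ∑ l ∈ range b, (h (a - l) - h (-l)) = ∑ j ∈ range a, (h (j + 1) - h (j + 1 - b)) := by
  simp only [← tel1, ← tel2]
  rw [Finset.sum_comm]

open Finset in
theorem main_add {G : Type*} [AddCommGroup G] (lam mu : YoungDiagram) (f : ℤ → ℤ → G) :
    ∑ c ∈ lam.cells, f ((lam.colLen c.2 : ℤ) - (c.1 : ℤ)) ((c.2 : ℤ) + 1 - (mu.rowLen c.1 : ℤ)) +
    ∑ c ∈ mu.cells, f ((c.1 : ℤ) + 1 - (mu.colLen c.2 : ℤ)) ((lam.rowLen c.1 : ℤ) - (c.2 : ℤ)) =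
    ∑ c ∈ lam.cells, f (c.1 + 1) (c.2 + 1) + ∑ c ∈ mu.cells, f (-c.1) (-c.2) +
    ∑ c' ∈ mu.cells, ∑ c ∈ lam.cells, Sbox f ((c.1 : ℤ) - c'.1) ((c.2 : ℤ) - c'.2) := by
  obtain ⟨n, hl, hm⟩ : ∃ n, lam.colLen 0 ≤ n ∧ mu.colLen 0 ≤ n :=
    ⟨max (lam.colLen 0) (mu.colLen 0), le_max_left _ _, le_max_right _ _⟩
  have E1 := cells_sum lam n hl (fun i j =>
    f ((lam.colLen j : ℤ) - (i : ℤ)) ((j : ℤ) + 1 - (mu.rowLen i : ℤ)))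
  have E2 := cells_sum mu n hm (fun i j =>
    f ((i : ℤ) + 1 - (mu.colLen j : ℤ)) ((lam.rowLen i : ℤ) - (j : ℤ)))
  have E3 := cells_sum lam n hl (fun i j => f ((i : ℤ) + 1) ((j : ℤ) + 1))
  have E4 := cells_sum mu n hm (fun i j => f (-(i : ℤ)) (-(j : ℤ)))
  have E5 : ∑ c' ∈ mu.cells, ∑ c ∈ lam.cells, Sbox f ((c.1 : ℤ) - c'.1) ((c.2 : ℤ) - c'.2) =
      ∑ i ∈ range n, ∑ k ∈ range n, ∑ l ∈ range (mu.rowLen k), ∑ j ∈ range (lam.rowLen i),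
        Sbox f ((i : ℤ) - k) ((j : ℤ) - l) := by
    rw [cells_sum mu n hm (fun k l => ∑ c ∈ lam.cells, Sbox f ((c.1 : ℤ) - k) ((c.2 : ℤ) - l)),
      Finset.sum_comm (s := range n) (t := range n)]
    refine Finset.sum_congr rfl fun k _ => ?_
    rw [Finset.sum_comm (s := range n) (t := range (mu.rowLen k))]
    refine Finset.sum_congr rfl fun l _ => ?_
    exact cells_sum lam n hl (fun i j => Sbox f ((i : ℤ) - k) ((j : ℤ) - l))
  have R1 : ∀ i, ∑ j ∈ range (lam.rowLen i),
      f ((lam.colLen j : ℤ) - (i : ℤ)) ((j : ℤ) + 1 - (mu.rowLen i : ℤ)) =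
      _ := fun i => row_leg lam n hl i
      (fun x j => f ((x : ℤ) - (i : ℤ)) ((j : ℤ) + 1 - (mu.rowLen i : ℤ)))
  have R2 : ∀ i, ∑ j ∈ range (mu.rowLen i),
      f ((i : ℤ) + 1 - (mu.colLen j : ℤ)) ((lam.rowLen i : ℤ) - (j : ℤ)) =
      _ := fun i => row_leg mu n hm i
      (fun x j => f ((i : ℤ) + 1 - (x : ℤ)) ((lam.rowLen i : ℤ) - (j : ℤ)))
  have R3 : ∀ i ∈ range n, ∑ j ∈ range (lam.rowLen i), f ((i : ℤ) + 1) ((j : ℤ) + 1) =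
      _ := fun i hi => corr_tel n i (mem_range.1 hi)
        (fun x => ∑ j ∈ range (lam.rowLen i), f (x + 1) ((j : ℤ) + 1))
  have R4 : ∀ i ∈ range n, ∑ j ∈ range (mu.rowLen i), f (-(i : ℤ)) (-(j : ℤ)) =
      _ := fun i hi => corr_tel n i (mem_range.1 hi)
        (fun x => ∑ j ∈ range (mu.rowLen i), f (-x) (-(j : ℤ)))
  have D : ∀ X : ℕ → G, ∑ i ∈ range n, X i = ∑ i ∈ range n, ∑ k ∈ range n,
      if i = k then X i else 0 := by
    intro X
    refine Finset.sum_congr rfl fun i hi => ?_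
    rw [Finset.sum_ite_eq, if_pos hi]
  rw [E1, E2, E3, E4, E5, Finset.sum_congr rfl R3, Finset.sum_congr rfl R4]
  simp only [R1, R2]
  simp only [Finset.sum_add_distrib (s := range n)]
  rw [Finset.sum_comm (s := range n) (t := range n) (f := fun i k => if i ≤ k then
    ∑ j ∈ range (lam.rowLen k), (f (((k + 1 : ℕ) : ℤ) - (i : ℤ)) ((j : ℤ) + 1 - (mu.rowLen i : ℤ))
     - f ((k : ℤ) - (i : ℤ)) ((j : ℤ) + 1 - (mu.rowLen i : ℤ))) else 0)]
  rw [Finset.sum_comm (s := range n) (t := range n) (f := fun i k => if k < i then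
    ∑ j ∈ range (mu.rowLen i), f (-((i : ℤ) - k)) (-(j : ℤ)) -
    ∑ j ∈ range (mu.rowLen i), f (-((i : ℤ) - k - 1)) (-(j : ℤ)) else 0)]
  rw [D (fun i => ∑ j ∈ range (lam.rowLen i), f ((i : ℤ) - i) ((j : ℤ) + 1 - (mu.rowLen i : ℤ))),
    D (fun i => ∑ j ∈ range (mu.rowLen i), f ((i : ℤ) + 1 - i) ((lam.rowLen i : ℤ) - (j : ℤ))),
    D (fun i => ∑ j ∈ range (lam.rowLen i), f (0 + 1) ((j : ℤ) + 1)),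
    D (fun i => ∑ j ∈ range (mu.rowLen i), f (-0) (-(j : ℤ)))]
  simp only [← Finset.sum_add_distrib (s := range n)]
  refine Finset.sum_congr rfl fun i _ => Finset.sum_congr rfl fun k _ => ?_
  rw [P_l]
  rcases lt_trichotomy i k with h | h | h
  · simp only [h, h.le, h.ne, not_le.2 h, not_lt.2 h.le, if_true, if_false, zero_add, add_zero]
    simp only [Finset.sum_sub_distrib, Nat.cast_add, Nat.cast_one]
    simp only [show (i : ℤ) + 1 - (k + 1) = i - k by ring, show (i : ℤ) + 1 - k = i - k + 1 by ring,
      show -((k : ℤ) - i) = i - k by ring, show -((k : ℤ) - i - 1) = i - k + 1 by ring]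
    abel
  · subst h
    simp only [le_refl, lt_irrefl, if_true, if_false, zero_add, add_zero]
    have := P_tel (f 1) (lam.rowLen i) (mu.rowLen i)
    simp only [Finset.sum_sub_distrib, Nat.cast_add, Nat.cast_one, neg_zero, sub_self, zero_add,
      add_sub_cancel_left] at this ⊢
    rw [this]
    abel
  · simp only [h, h.le, h.ne', not_le.2 h, not_lt.2 h.le, if_true, if_false, zero_add, add_zero]
    rw [P_tel (f _), P_tel (f _)]
    simp only [Finset.sum_sub_distrib, Nat.cast_add, Nat.cast_one]
    simp only [show (i : ℤ) + 1 - k = i - k + 1 by ring, sub_add_cancel]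
    abel

theorem sw_add {G : Type*} [AddCommGroup G] (x1 x2 x3 x4 : G) :
    x2 - x1 - (x4 - x3) = x3 - x4 - (x1 - x2) := by abel

theorem nat_ne (a1 a2 b1 b2 : ℕ) : z * q1 ^ a1 * q2 ^ b1 ≠ q1 ^ a2 * q2 ^ b2 := by
  unfold z q1 q2
  simp only [← map_pow, ← map_mul]
  intro h
  have h := IsFractionRing.injective (MvPolynomial (Fin 3) ℚ) K h
  have h := congrArg (MvPolynomial.eval (fun i : Fin 3 => if i = 2 then (0 : ℚ) else 1)) h
  simp at h

theorem f_ne_s4 (a b : ℤ) : 1 - z * q1 ^ a * q2 ^ b ≠ 0 := by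
  obtain ⟨a1, a2, rfl⟩ : ∃ m n : ℕ, a = m - n := ⟨a.toNat, (-a).toNat, by omega⟩
  obtain ⟨b1, b2, rfl⟩ : ∃ m n : ℕ, b = m - n := ⟨b.toNat, (-b).toNat, by omega⟩
  have h := nat_ne a1 a2 b1 b2
  intro h'
  apply h
  rw [zpow_sub₀ q1_ne, zpow_sub₀ q2_ne] at h'
  simp only [zpow_natCast] at h'
  have := q1_ne
  have := q2_ne
  field_simp at h'
  linear_combination -h'

def fU (a b : ℤ) : Kˣ := Units.mk0 _ (f_ne_s4 a b)

theorem fU_val (a b : ℤ) : (fU a b : K) = 1 - z * q1 ^ a * q2 ^ b := rfl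

theorem AR_prod (d : YoungDiagram) (g : ℕ → ℕ → Kˣ) :
    (∏ c ∈ addables d, g c.1 c.2) / (∏ c ∈ removables d, g (c.1 + 1) (c.2 + 1)) =
    g 0 0 * ∏ c ∈ d.cells, ((g c.1 (c.2 + 1) / g c.1 c.2)
      / (g (c.1 + 1) (c.2 + 1) / g (c.1 + 1) c.2)) :=
  AR_sum (G := Additive Kˣ) d g

def SU (a b : ℤ) : Kˣ := (fU a (b + 1) / fU a b) / (fU (a + 1) (b + 1) / fU (a + 1) b)

theorem main_prod (lam mu : YoungDiagram) :
    (∏ c ∈ lam.cells, fU ((lam.colLen c.2 : ℤ) - (c.1 : ℤ))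
      ((c.2 : ℤ) + 1 - (mu.rowLen c.1 : ℤ))) *
    ∏ c ∈ mu.cells, fU ((c.1 : ℤ) + 1 - (mu.colLen c.2 : ℤ))
      ((lam.rowLen c.1 : ℤ) - (c.2 : ℤ)) =
    ((∏ c ∈ lam.cells, fU (c.1 + 1) (c.2 + 1)) * ∏ c ∈ mu.cells, fU (-c.1) (-c.2)) *
    ∏ c' ∈ mu.cells, ∏ c ∈ lam.cells, SU ((c.1 : ℤ) - c'.1) ((c.2 : ℤ) - c'.2) :=
  main_add (G := Additive Kˣ) lam mu fU

theorem Ycal_units (d : YoungDiagram) (w : K) (g : ℕ → ℕ → Kˣ)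
    (hg : ∀ i j, (g i j : K) = 1 - chi (i, j) / w) :
    Ycal d w = ((g 0 0 * ∏ c ∈ d.cells, ((g c.1 (c.2 + 1) / g c.1 c.2)
      / (g (c.1 + 1) (c.2 + 1) / g (c.1 + 1) c.2)) : Kˣ) : K) := by
  rw [← AR_prod, Units.val_div_eq_div_val, Units.coe_prod, Units.coe_prod]
  unfold Ycal
  congr 1
  · exact Finset.prod_congr rfl fun c _ => (hg _ _).symm
  · refine Finset.prod_congr rfl fun c _ => ?_
    rw [hg]
    unfold chi q3
    have := q1_ne
    have := q2_ne
    by_cases hw : w = 0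
    · simp [hw]
    · field_simp
      ring

theorem Y1 (lam : YoungDiagram) (c' : ℕ × ℕ) :
    Ycal lam (chi c' / z) = ((fU (-c'.1) (-c'.2) *
      ∏ c ∈ lam.cells, SU ((c.1 : ℤ) - c'.1) ((c.2 : ℤ) - c'.2) : Kˣ) : K) := by
  rw [Ycal_units lam _ (fun i j => fU ((i : ℤ) - c'.1) ((j : ℤ) - c'.2))]
  · simp only [Nat.cast_add, Nat.cast_one, Nat.cast_zero, zero_sub, SU, add_sub_right_comm]
  · intro i j
    rw [fU_val, zpow_sub₀ q1_ne, zpow_sub₀ q2_ne]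
    have := q1_ne
    have := q2_ne
    have := z_ne
    simp only [zpow_natCast, chi]
    field_simp

def monU (i j : ℤ) : Kˣ :=
  Units.mk0 (-(q1 ^ i * q2 ^ j / z))
    (neg_ne_zero.2 (div_ne_zero (mul_ne_zero (zpow_ne_zero _ q1_ne) (zpow_ne_zero _ q2_ne)) z_ne))

theorem mon_box (a b : ℤ) :
    (monU a (b + 1) / monU a b) / (monU (a + 1) (b + 1) / monU (a + 1) b) = 1 := by
  ext
  simp only [Units.val_div_eq_div_val, Units.val_one, monU, Units.val_mk0, zpow_add₀ q1_ne,
    zpow_add₀ q2_ne, zpow_one]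
  have := q1_ne
  have := q2_ne
  have := z_ne
  have := zpow_ne_zero a q1_ne
  have := zpow_ne_zero b q2_ne
  field_simp

theorem Y2 (mu : YoungDiagram) (c : ℕ × ℕ) :
    (-q3⁻¹ * z * chi c) * Ycal mu (q3⁻¹ * z * chi c) = ((fU (c.1 + 1) (c.2 + 1) *
      ∏ c' ∈ mu.cells, SU ((c.1 : ℤ) - c'.1) ((c.2 : ℤ) - c'.2) : Kˣ) : K) := by
  have e1 := q1_ne
  have e2 := q2_ne
  have e3 := z_ne
  rw [Ycal_units mu _ (fun i j => monU ((i : ℤ) - c.1 - 1) ((j : ℤ) - c.2 - 1) *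
    fU ((c.1 : ℤ) + 1 - i) ((c.2 : ℤ) + 1 - j))]
  · rw [Units.val_mul, Units.val_mul, ← mul_assoc]
    congr 1
    · simp only [monU, Units.val_mk0, zpow_sub₀ e1, zpow_sub₀ e2, Nat.cast_zero,
        sub_zero, zpow_natCast, zpow_zero, zpow_one, chi, q3]
      field_simp
      try ring
    · congr 1
      refine Finset.prod_congr rfl fun c' _ => ?_
      have h := mon_box ((c'.1 : ℤ) - c.1 - 1) ((c'.2 : ℤ) - c.2 - 1)
      rw [show (c'.1 : ℤ) - c.1 - 1 + 1 = c'.1 + 1 - c.1 - 1 by ring,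
        show (c'.2 : ℤ) - c.2 - 1 + 1 = c'.2 + 1 - c.2 - 1 by ring] at h
      simp only [Nat.cast_add, Nat.cast_one, mul_div_mul_comm, h, one_mul, SU]
      simp only [show (c.1 : ℤ) + 1 - (c'.1 + 1) = c.1 - c'.1 by ring,
        show (c.2 : ℤ) + 1 - (c'.2 + 1) = c.2 - c'.2 by ring,
        show (c.1 : ℤ) + 1 - c'.1 = c.1 - c'.1 + 1 by ring,
        show (c.2 : ℤ) + 1 - c'.2 = c.2 - c'.2 + 1 by ring]
      generalize fU ((c.1 : ℤ) - c'.1 + 1) ((c.2 : ℤ) - c'.2 + 1) = x1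
      generalize fU ((c.1 : ℤ) - c'.1 + 1) ((c.2 : ℤ) - c'.2) = x2
      generalize fU ((c.1 : ℤ) - c'.1) ((c.2 : ℤ) - c'.2 + 1) = x3
      generalize fU ((c.1 : ℤ) - c'.1) ((c.2 : ℤ) - c'.2) = x4
      exact sw_add (G := Additive Kˣ) x1 x2 x3 x4
  · intro i j
    simp only [Units.val_mul, monU, Units.val_mk0, fU_val, zpow_sub₀ e1, zpow_sub₀ e2,
      zpow_add₀ e1, zpow_add₀ e2, zpow_natCast, zpow_one, chi, q3]
    field_simp
    try ring

theorem nek_eq (lam mu : YoungDiagram) : nek lam mu z =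
    ((((∏ c ∈ lam.cells, fU (c.1 + 1) (c.2 + 1)) * ∏ c ∈ mu.cells, fU (-c.1) (-c.2)) *
    ∏ c' ∈ mu.cells, ∏ c ∈ lam.cells, SU ((c.1 : ℤ) - c'.1) ((c.2 : ℤ) - c'.2) : Kˣ) : K) := by
  rw [← main_prod, Units.val_mul, Units.coe_prod, Units.coe_prod]
  rfl

theorem lam_eq (lam : YoungDiagram) : ∏ c ∈ lam.cells, (1 - q3⁻¹ * z * chi c) =
    ((∏ c ∈ lam.cells, fU (c.1 + 1) (c.2 + 1) : Kˣ) : K) := by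
  rw [Units.coe_prod]
  refine Finset.prod_congr rfl fun c _ => ?_
  rw [fU_val, zpow_add₀ q1_ne, zpow_add₀ q2_ne]
  simp only [zpow_natCast, zpow_one, chi, q3, inv_inv]
  ring

theorem mu_eq (mu : YoungDiagram) : ∏ c ∈ mu.cells, (1 - z * (chi c)⁻¹) =
    ((∏ c ∈ mu.cells, fU (-c.1) (-c.2) : Kˣ) : K) := by
  rw [Units.coe_prod]
  refine Finset.prod_congr rfl fun c _ => ?_
  rw [fU_val]
  simp only [zpow_natCast, zpow_neg, chi, mul_inv]
  ring

/-- For all partitions `λ, μ`, in `ℚ(q1,q2,z)`: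
`N_{λ,μ}(z) = ∏_{c∈λ} (1 − q3⁻¹ z χ_c) · ∏_{c'∈μ} Y_λ(χ_{c'}/z)` and
`N_{λ,μ}(z) = ∏_{c'∈μ} (1 − z χ_{c'}⁻¹) · ∏_{c∈λ} ((−q3⁻¹ z χ_c) · Y_μ(q3⁻¹ z χ_c))`. -/
theorem stmt4 (lam mu : YoungDiagram) :
    (nek lam mu z
        = (∏ c ∈ lam.cells, (1 - q3⁻¹ * z * chi c)) *
            ∏ c' ∈ mu.cells, Ycal lam (chi c' / z)) ∧
      nek lam mu z
        = (∏ c' ∈ mu.cells, (1 - z * (chi c')⁻¹)) *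
            ∏ c ∈ lam.cells, ((-q3⁻¹ * z * chi c) * Ycal mu (q3⁻¹ * z * chi c)) := by
  constructor
  · rw [nek_eq, lam_eq, Finset.prod_congr rfl fun c' _ => Y1 lam c', ← Units.coe_prod,
      ← Units.val_mul, Finset.prod_mul_distrib, mul_assoc]
  · rw [nek_eq, mu_eq, Finset.prod_congr rfl fun c _ => Y2 mu c, ← Units.coe_prod,
      ← Units.val_mul, Finset.prod_mul_distrib, Finset.prod_comm]
    congr 1
    rw [mul_comm (∏ c ∈ lam.cells, _) (∏ c ∈ mu.cells, _), mul_assoc]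

end
end

section
/- For all partitions λ and μ, the following identity holds in ℚ(q1,q2,z): Ñ_{μ,λ}(z) · N_{μ,λ}(q3 z) = q3^{|μ|} · Ñ_{λ,μ}(z^{−1}) · N_{μ,λ}(z). -/
open scoped BigOperators

noncomputable section

/-- The modified Nekrasov factor `Ñ_{λ,μ}(w) = N_{λ,μ}(w) · ∏_{c∈λ} (−q3⁻¹ w χ_c)⁻¹`. -/
def nekT (lam mu : YoungDiagram) (w : K) : K :=
  nek lam mu w * (∏ c ∈ lam.cells, (-q3⁻¹ * w * chi c))⁻¹

theorem prod_mono_aux (S : Finset (ℕ × ℕ)) (w : K) (f g : ℕ × ℕ → ℤ) :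
    ∏ c ∈ S, (w * q1 ^ f c * q2 ^ g c)
      = w ^ S.card * q1 ^ (∑ c ∈ S, f c) * q2 ^ (∑ c ∈ S, g c) := by
  classical
  induction S using Finset.induction_on with
  | empty => simp
  | insert a S ha ih =>
    rw [Finset.prod_insert ha, ih, Finset.sum_insert ha, Finset.sum_insert ha,
      Finset.card_insert_of_notMem ha, zpow_add₀ q1_ne, zpow_add₀ q2_ne, pow_succ]
    ring

theorem sum_col_aux (d : YoungDiagram) :
    ∑ c ∈ d.cells, ((d.colLen c.2 : ℤ) - 1 - (c.1 : ℤ)) = ∑ c ∈ d.cells, (c.1 : ℤ) := by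
  refine Finset.sum_nbij' (fun c => (d.colLen c.2 - 1 - c.1, c.2))
    (fun c => (d.colLen c.2 - 1 - c.1, c.2)) ?_ ?_ ?_ ?_ ?_
  all_goals
    rintro ⟨i, j⟩ hc
    have h1 : i < d.colLen j := YoungDiagram.mem_iff_lt_colLen.1 ((YoungDiagram.mem_cells _).1 hc)
  · exact (YoungDiagram.mem_cells _).2 (YoungDiagram.mem_iff_lt_colLen.2 (by dsimp only; omega))
  · exact (YoungDiagram.mem_cells _).2 (YoungDiagram.mem_iff_lt_colLen.2 (by dsimp only; omega))
  · simp only [Prod.mk.injEq, and_true]; omega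
  · simp only [Prod.mk.injEq, and_true]; omega
  · dsimp only; omega

theorem sum_row_aux (lam mu : YoungDiagram) :
    ∑ c ∈ lam.cells, (mu.rowLen c.1 : ℤ) = ∑ c ∈ mu.cells, (lam.rowLen c.1 : ℤ) := by
  have h : ∀ (d : YoungDiagram) (i : ℕ),
      (d.rowLen i : ℤ) = ∑ c ∈ d.cells, if c.1 = i then (1 : ℤ) else 0 := by
    intro d i
    rw [YoungDiagram.rowLen_eq_card, YoungDiagram.row, Finset.card_filter]
    push_cast
    rfl
  simp_rw [h]
  rw [Finset.sum_comm]
  simp_rw [eq_comm]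

theorem flip_aux (x w a b a' b' : K) (h : (x * a * b) * (w * a' * b') = 1) :
    1 - x * a * b = (-x * a * b) * (1 - w * a' * b') := by
  linear_combination -h

theorem nek_flip (lam mu : YoungDiagram) :
    nek lam mu z⁻¹ = nek mu lam (q3 * z) *
      ((∏ c ∈ lam.cells, (-z⁻¹ * q1 ^ ((lam.colLen c.2 : ℤ) - (c.1 : ℤ)) *
        q2 ^ ((c.2 : ℤ) + 1 - (mu.rowLen c.1 : ℤ)))) *
      ∏ c ∈ mu.cells, (-z⁻¹ * q1 ^ ((c.1 : ℤ) + 1 - (mu.colLen c.2 : ℤ)) *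
        q2 ^ ((lam.rowLen c.1 : ℤ) - (c.2 : ℤ)))) := by
  have hz := z_ne
  have h1 := q1_ne
  have h2 := q2_ne
  have key : ∀ a b a' b' : ℤ, a + a' = 1 → b + b' = 1 →
      1 - z⁻¹ * q1 ^ a * q2 ^ b
        = (-z⁻¹ * q1 ^ a * q2 ^ b) * (1 - q3 * z * q1 ^ a' * q2 ^ b') := by
    intro a b a' b' ha hb
    apply flip_aux
    obtain rfl : a' = 1 - a := by omega
    obtain rfl : b' = 1 - b := by omega
    rw [zpow_sub₀ h1, zpow_sub₀ h2, q3]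
    have := zpow_ne_zero a h1
    have := zpow_ne_zero b h2
    simp only [zpow_one]
    field_simp
  have e1 : ∏ c ∈ lam.cells, (1 - z⁻¹ * q1 ^ ((lam.colLen c.2 : ℤ) - (c.1 : ℤ)) *
        q2 ^ ((c.2 : ℤ) + 1 - (mu.rowLen c.1 : ℤ))) = _ :=
    Finset.prod_congr rfl fun c _ => key _ _ ((c.1 : ℤ) + 1 - (lam.colLen c.2 : ℤ))
      ((mu.rowLen c.1 : ℤ) - (c.2 : ℤ)) (by ring) (by ring)
  have e2 : ∏ c ∈ mu.cells, (1 - z⁻¹ * q1 ^ ((c.1 : ℤ) + 1 - (mu.colLen c.2 : ℤ)) *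
        q2 ^ ((lam.rowLen c.1 : ℤ) - (c.2 : ℤ))) = _ :=
    Finset.prod_congr rfl fun c _ => key _ _ ((mu.colLen c.2 : ℤ) - (c.1 : ℤ))
      ((c.2 : ℤ) + 1 - (lam.rowLen c.1 : ℤ)) (by ring) (by ring)
  unfold nek
  rw [Finset.prod_mul_distrib] at e1 e2
  rw [e1, e2]
  ring

theorem chi_prod (d : YoungDiagram) (w : K) :
    ∏ c ∈ d.cells, (-q3⁻¹ * w * chi c) = (-q3⁻¹ * w) ^ d.cells.card *
      q1 ^ (∑ c ∈ d.cells, (c.1 : ℤ)) * q2 ^ (∑ c ∈ d.cells, (c.2 : ℤ)) := by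
  rw [← prod_mono_aux]
  refine Finset.prod_congr rfl fun c _ => ?_
  simp only [chi, zpow_natCast]
  ring

theorem mono_id (lam mu : YoungDiagram) :
    (∏ c ∈ mu.cells, (-q3⁻¹ * z * chi c))⁻¹ = q3 ^ mu.cells.card *
      ((∏ c ∈ lam.cells, (-z⁻¹ * q1 ^ ((lam.colLen c.2 : ℤ) - (c.1 : ℤ)) *
        q2 ^ ((c.2 : ℤ) + 1 - (mu.rowLen c.1 : ℤ)))) *
      ∏ c ∈ mu.cells, (-z⁻¹ * q1 ^ ((c.1 : ℤ) + 1 - (mu.colLen c.2 : ℤ)) *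
        q2 ^ ((lam.rowLen c.1 : ℤ) - (c.2 : ℤ)))) *
      (∏ c ∈ lam.cells, (-q3⁻¹ * z⁻¹ * chi c))⁻¹ := by
  have hz := z_ne
  have h1 := q1_ne
  have h2 := q2_ne
  rw [chi_prod, chi_prod, prod_mono_aux, prod_mono_aux]
  have s1 : ∑ c ∈ lam.cells, ((lam.colLen c.2 : ℤ) - (c.1 : ℤ))
      = ∑ c ∈ lam.cells, (c.1 : ℤ) + lam.cells.card := by
    rw [← sum_col_aux lam, Finset.card_eq_sum_ones]
    push_cast
    rw [← Finset.sum_add_distrib]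
    exact Finset.sum_congr rfl fun c _ => by ring
  have s2 : ∑ c ∈ mu.cells, ((c.1 : ℤ) + 1 - (mu.colLen c.2 : ℤ))
      = - ∑ c ∈ mu.cells, (c.1 : ℤ) := by
    rw [← sum_col_aux mu, ← Finset.sum_neg_distrib]
    exact Finset.sum_congr rfl fun c _ => by ring
  have s3 : ∑ c ∈ lam.cells, ((c.2 : ℤ) + 1 - (mu.rowLen c.1 : ℤ))
      = ∑ c ∈ lam.cells, (c.2 : ℤ) + lam.cells.card
        - ∑ c ∈ mu.cells, (lam.rowLen c.1 : ℤ) := by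
    rw [← sum_row_aux lam mu, Finset.sum_sub_distrib, Finset.sum_add_distrib]
    simp
  rw [s1, s2, s3, Finset.sum_sub_distrib]
  generalize ∑ c ∈ lam.cells, (c.1 : ℤ) = A
  generalize ∑ c ∈ mu.cells, (c.1 : ℤ) = B
  generalize ∑ c ∈ lam.cells, (c.2 : ℤ) = C
  generalize ∑ c ∈ mu.cells, (c.2 : ℤ) = D
  generalize ∑ c ∈ mu.cells, (lam.rowLen c.1 : ℤ) = R
  generalize lam.cells.card = l
  generalize mu.cells.card = m
  rw [zpow_add₀ h1, zpow_sub₀ h2, zpow_sub₀ h2, zpow_add₀ h2, zpow_neg, zpow_natCast,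
    zpow_natCast]
  have n1 := zpow_ne_zero A h1
  have n2 := zpow_ne_zero B h1
  have n3 := zpow_ne_zero C h2
  have n4 := zpow_ne_zero D h2
  have n5 := zpow_ne_zero R h2
  generalize q1 ^ A = A at *
  generalize q1 ^ B = B at *
  generalize q2 ^ C = C at *
  generalize q2 ^ D = D at *
  generalize q2 ^ R = R at *
  have g1 : (-q3⁻¹ * z) ^ m = (-1) ^ m * (q1 ^ m * q2 ^ m * z ^ m) := by
    rw [q3, inv_inv, ← mul_pow, ← mul_pow, ← mul_pow]; congr 1; ring
  have g2 : (-q3⁻¹ * z⁻¹) ^ l = (-z⁻¹) ^ l * (q1 ^ l * q2 ^ l) := by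
    rw [q3, inv_inv, ← mul_pow, ← mul_pow]; congr 1; ring
  have g3 : (-z⁻¹) ^ m = (-1) ^ m * (z ^ m)⁻¹ := by
    rw [← inv_pow, ← mul_pow]; congr 1; ring
  have g4 : ((-1 : K) ^ m)⁻¹ = (-1) ^ m := by
    rw [← inv_pow]; congr 1; norm_num
  have n6 : (-z⁻¹) ^ l ≠ 0 := pow_ne_zero _ (neg_ne_zero.2 (inv_ne_zero hz))
  rw [g1, g2, g3, q3, inv_pow, mul_pow]
  generalize (-z⁻¹) ^ l = Z at *
  simp only [mul_inv, g4]
  field_simp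

/-- For all partitions `λ, μ`, in `ℚ(q1,q2,z)`:
`Ñ_{μ,λ}(z) · N_{μ,λ}(q3 z) = q3^{|μ|} · Ñ_{λ,μ}(z⁻¹) · N_{μ,λ}(z)`. -/
theorem stmt16 (lam mu : YoungDiagram) :
    nekT mu lam z * nek mu lam (q3 * z)
      = q3 ^ mu.cells.card * nekT lam mu z⁻¹ * nek mu lam z := by
  unfold nekT
  rw [mono_id lam mu, nek_flip lam mu]
  ring

end
end
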